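/- Let (f,C) be a low-defect pair of degree r, s ≥ 0 a real number, and S = {(k₁,…,k_r) ∈ ℤ≥0^r : δ_{f,C}(k₁,…,k_r) < s}. Then there exists a finite set T ⊆ (ℤ≥0 ∪ {∗})^r such that: (1) S = ⋃_{p∈T} S(p); and (2) for each p ∈ T, the set of variables xᵢ with pᵢ ≠ ∗ is downward closed under the nesting order of f, the 3-substitution (g,D) of p into (f,C) is a truncation of (f,C), and δ(g,D) ≤ s (hence deg g ≤ ⌊s⌋), with δ(g,D) < s if g has degree 0. -/

import Mathlib

/-- `CpxW n k` : the positive integer `n` can be written using exactly `k` ones,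
with an arbitrary combination of additions and multiplications. -/
inductive CpxW : ℕ → ℕ → Prop
  | one : CpxW 1 1
  | add {a b m n : ℕ} : CpxW a m → CpxW b n → CpxW (a + b) (m + n)
  | mul {a b m n : ℕ} : CpxW a m → CpxW b n → CpxW (a * b) (m + n)

/-- The integer complexity `‖n‖`: the least number of 1's needed to write `n`
using additions and multiplications. -/
noncomputable def cpx (n : ℕ) : ℕ := sInf {k | CpxW n k}

/-- The defect `δ(n) = ‖n‖ - 3 log₃ n`. -/
noncomputable def defect (n : ℕ) : ℝ := (cpx n : ℝ) - 3 * Real.logb 3 (n : ℝ)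

/-- `LDP r f C` : `(f, C)` is a low-defect pair of degree `r`; here a low-defect
polynomial of degree `r` is written in the variables `X 0, …, X (r-1)`. -/
inductive LDP : ℕ → MvPolynomial ℕ ℤ → ℕ → Prop
  | const (k C : ℕ) (hk : 0 < k) (hC : cpx k ≤ C) :
      LDP 0 (MvPolynomial.C (k : ℤ)) C
  | mul {r₁ r₂ : ℕ} {f₁ f₂ : MvPolynomial ℕ ℤ} {C₁ C₂ : ℕ} :
      LDP r₁ f₁ C₁ → LDP r₂ f₂ C₂ →
      LDP (r₁ + r₂) (f₁ * MvPolynomial.rename (· + r₁) f₂) (C₁ + C₂)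
  | step {r : ℕ} {f : MvPolynomial ℕ ℤ} {C : ℕ} (c D : ℕ) (hc : 0 < c) (hD : cpx c ≤ D) :
      LDP r f C → LDP (r + 1) (f * MvPolynomial.X r + MvPolynomial.C (c : ℤ)) (C + D)

/-- A low-defect polynomial: the first component of some low-defect pair. -/
def LowDefectPoly (f : MvPolynomial ℕ ℤ) : Prop := ∃ r C, LDP r f C

/-- The leading coefficient of a low-defect polynomial of degree `r`:
the coefficient of `x₁ ⋯ x_r`. -/
noncomputable def leadCoeff (r : ℕ) (f : MvPolynomial ℕ ℤ) : ℤ :=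
  MvPolynomial.coeff (∑ i ∈ Finset.range r, Finsupp.single i 1) f

/-- The defect `δ(f,C) = C - 3 log₃ a` of a low-defect pair of degree `r`,
where `a` is the leading coefficient. -/
noncomputable def pairDft (r : ℕ) (f : MvPolynomial ℕ ℤ) (C : ℕ) : ℝ :=
  (C : ℝ) - 3 * Real.logb 3 ((leadCoeff r f : ℤ) : ℝ)

/-- `f(3^{k₁}, …, 3^{k_r})` for a polynomial of degree `r`. -/
noncomputable def eval3 (r : ℕ) (f : MvPolynomial ℕ ℤ) (k : ℕ → ℕ) : ℤ :=
  MvPolynomial.eval (fun i => if i < r then (3 : ℤ) ^ (k i) else 1) f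

/-- `δ_{f,C}(k₁,…,k_r) = C + 3(k₁+⋯+k_r) - 3 log₃ f(3^{k₁},…,3^{k_r})`. -/
noncomputable def dftF (r : ℕ) (f : MvPolynomial ℕ ℤ) (C : ℕ) (k : ℕ → ℕ) : ℝ :=
  (C : ℝ) + 3 * (∑ i ∈ Finset.range r, (k i : ℝ))
    - 3 * Real.logb 3 ((eval3 r f k : ℤ) : ℝ)

/-- The nesting order: `NestLe f i j` means `xᵢ ⪯ xⱼ`, i.e. every monomial of `f`
divisible by `xᵢ` is divisible by `xⱼ`. -/
def NestLe (f : MvPolynomial ℕ ℤ) (i j : ℕ) : Prop :=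
  ∀ m ∈ f.support, m i ≠ 0 → m j ≠ 0

/-- `xᵢ` is a variable of (the degree-`r` polynomial) `f` that is minimal with
respect to the nesting order. -/
def IsMinVar (r : ℕ) (f : MvPolynomial ℕ ℤ) (i : ℕ) : Prop :=
  i < r ∧ ∀ j < r, NestLe f j i → NestLe f i j

/-- Substituting `3^k` for the variable `xᵢ` of `f`, renumbering the later
variables down by one. -/
noncomputable def truncAt (f : MvPolynomial ℕ ℤ) (i k : ℕ) : MvPolynomial ℕ ℤ :=
  MvPolynomial.aeval (fun j => if j < i then MvPolynomial.X j
    else if j = i then MvPolynomial.C ((3 : ℤ) ^ k) else MvPolynomial.X (j - 1)) f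

/-- A direct truncation of a "pair with degree" `(r, f, C)`: substitute `3^k`
into a variable of `f` minimal in the nesting order. -/
def DirectTrunc (a b : ℕ × MvPolynomial ℕ ℤ × ℕ) : Prop :=
  ∃ i k : ℕ, a.1 = b.1 + 1 ∧ IsMinVar a.1 a.2.1 i ∧
    b.2.1 = truncAt a.2.1 i k ∧ b.2.2 = a.2.2 + 3 * k

/-- `n` is a leader: either `3 ∤ n`, or `3 ∣ n` and `‖n‖ < ‖n/3‖ + 3`. -/
def IsLeader (n : ℕ) : Prop := 0 < n ∧ (3 ∣ n → cpx n < cpx (n / 3) + 3)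

/-- `(f, C)` (of degree `r`) efficiently 3-represents `n`. -/
def EffRep (r : ℕ) (f : MvPolynomial ℕ ℤ) (C : ℕ) (n : ℕ) : Prop :=
  ∃ k : ℕ → ℕ, (n : ℤ) = eval3 r f k ∧ cpx n = C + 3 * ∑ i ∈ Finset.range r, k i

/-- The number of `∗`-entries (free coordinates) of `p` among `0, …, r-1`. -/
def starCount (r : ℕ) (p : ℕ → Option ℕ) : ℕ :=
  ((Finset.range r).filter (fun i => p i = none)).card

/-- The 3-substitution of a tuple `p ∈ (ℤ≥0 ∪ {∗})^r` into `f`: substitute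
`3^{kᵢ}` for `xᵢ` whenever `p i = some kᵢ`, renumbering the surviving variables
in increasing order. -/
noncomputable def subst3 (f : MvPolynomial ℕ ℤ) (p : ℕ → Option ℕ) : MvPolynomial ℕ ℤ :=
  MvPolynomial.aeval (fun j =>
    match p j with
    | some k => MvPolynomial.C ((3 : ℤ) ^ k)
    | none => MvPolynomial.X (((Finset.range j).filter (fun i => p i = none)).card)) f

/-- The insertion map `ι` associated to `p`: inserts the arguments into the
coordinates of `p` equal to `∗`. -/
def iotaMap (p : ℕ → Option ℕ) (ℓ : ℕ → ℕ) : ℕ → ℕ := fun j =>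
  match p j with
  | some k => k
  | none => ℓ (((Finset.range j).filter (fun i => p i = none)).card)

theorem CpxW.one_le {n k : ℕ} (h : CpxW n k) : 1 ≤ n ∧ 1 ≤ k := by
  induction h with
  | one => simp
  | add _ _ h₁ h₂ => omega
  | mul _ _ h₁ h₂ => exact ⟨Nat.mul_pos h₁.1 h₂.1, by omega⟩

theorem CpxW.self {n : ℕ} (hn : 0 < n) : CpxW n n := by
  induction n, hn using Nat.le_induction with
  | base => exact .one
  | succ n _ ih => exact ih.add .one

theorem cpxW_cpx {n : ℕ} (hn : 0 < n) : CpxW n (cpx n) :=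
  Nat.sInf_mem (s := {k | CpxW n k}) ⟨n, CpxW.self hn⟩

theorem CpxW.cpx_le {n k : ℕ} (h : CpxW n k) : cpx n ≤ k := Nat.sInf_le h

theorem CpxW.mul_three_pow {n m : ℕ} (h : CpxW n m) (k : ℕ) :
    CpxW (n * 3 ^ k) (m + 3 * k) := by
  induction k with
  | zero => simpa using h
  | succ k ih =>
    have h3 : CpxW 3 3 := CpxW.self (by norm_num)
    have := ih.mul h3
    rwa [mul_assoc, ← pow_succ, add_assoc] at this

theorem one_le_cpx {n : ℕ} (hn : 0 < n) : 1 ≤ cpx n := (cpxW_cpx hn).one_le.2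

theorem cpx_mul_le {a b : ℕ} (ha : 0 < a) (hb : 0 < b) : cpx (a * b) ≤ cpx a + cpx b :=
  ((cpxW_cpx ha).mul (cpxW_cpx hb)).cpx_le

theorem cpx_mul_three_pow_add_le {a c : ℕ} (ha : 0 < a) (hc : 0 < c) (k : ℕ) :
    cpx (a * 3 ^ k + c) ≤ cpx a + 3 * k + cpx c :=
  (((cpxW_cpx ha).mul_three_pow k).add (cpxW_cpx hc)).cpx_le

/-- The bound `3 log₃ n ≤ k` in exponential form. -/
theorem CpxW.pow_three_le {n k : ℕ} (h : CpxW n k) : n ^ 3 ≤ 3 ^ k := by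
  have one_add : ∀ b m n : ℕ, 1 ≤ b → 1 ≤ m → 1 ≤ n → b ^ 3 ≤ 3 ^ n →
      (1 + b) ^ 3 ≤ 3 ^ (m + n) := by
    intro b m n hb hm hn hbn
    have hm3 : 3 ≤ 3 ^ m := by simpa using Nat.pow_le_pow_right (n := 3) (by norm_num) hm
    rw [pow_add]
    rcases (by omega : b = 1 ∨ b = 2 ∨ 3 ≤ b) with rfl | rfl | hb3
    · have hn3 : 3 ≤ 3 ^ n := by simpa using Nat.pow_le_pow_right (n := 3) (by norm_num) hn
      nlinarith
    · have hn2 : 2 ≤ n := by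
        by_contra hlt
        obtain rfl : n = 1 := by omega
        norm_num at hbn
      have hn3 : 3 ^ 2 ≤ 3 ^ n := Nat.pow_le_pow_right (by norm_num) hn2
      nlinarith
    · have : (1 + b) ^ 3 ≤ 3 * b ^ 3 := by
        obtain ⟨t, rfl⟩ := Nat.exists_eq_add_of_le hb3
        nlinarith [Nat.zero_le (t ^ 2), Nat.zero_le (t ^ 3)]
      calc (1 + b) ^ 3 ≤ 3 * b ^ 3 := this
        _ ≤ 3 ^ m * 3 ^ n := Nat.mul_le_mul hm3 hbn
  induction h with
  | one => norm_num
  | @add a b m n ha hb iha ihb =>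
    have ha1 := ha.one_le
    have hb1 := hb.one_le
    rcases (by omega : a = 1 ∨ b = 1 ∨ (2 ≤ a ∧ 2 ≤ b)) with rfl | rfl | ⟨ha2, hb2⟩
    · exact one_add b m n hb1.1 ha1.2 hb1.2 ihb
    · rw [add_comm a, add_comm m]
      exact one_add a n m ha1.1 hb1.2 ha1.2 iha
    · calc (a + b) ^ 3 ≤ (a * b) ^ 3 := Nat.pow_le_pow_left (by nlinarith) 3
        _ = a ^ 3 * b ^ 3 := mul_pow ..
        _ ≤ 3 ^ m * 3 ^ n := Nat.mul_le_mul iha ihb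
        _ = 3 ^ (m + n) := (pow_add ..).symm
  | @mul a b m n _ _ iha ihb =>
    rw [mul_pow, pow_add]
    exact Nat.mul_le_mul iha ihb

/-- The exponent of the monomial `x₁ ⋯ x_r`. -/
noncomputable def fullExp (r : ℕ) : ℕ →₀ ℕ := ∑ i ∈ Finset.range r, Finsupp.single i 1

theorem fullExp_apply (r i : ℕ) : fullExp r i = if i < r then 1 else 0 := by
  simp [fullExp, Finsupp.finsetSum_apply, Finsupp.single_apply]

theorem fullExp_succ (r : ℕ) : fullExp (r + 1) = fullExp r + Finsupp.single r 1 :=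
  Finset.sum_range_succ _ _

theorem mapDomain_add_apply (r : ℕ) (m : ℕ →₀ ℕ) (i : ℕ) :
    m.mapDomain (· + r) i = if r ≤ i then m (i - r) else 0 := by
  split_ifs with h
  · obtain ⟨j, rfl⟩ := Nat.exists_eq_add_of_le' h
    simpa using Finsupp.mapDomain_apply (add_left_injective r) m j
  · exact Finsupp.mapDomain_of_notMem_range _ _ (by rintro ⟨j, rfl⟩; simp at h)

theorem fullExp_add (r₁ r₂ : ℕ) :
    fullExp (r₁ + r₂) = fullExp r₁ + (fullExp r₂).mapDomain (· + r₁) := by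
  ext i
  simp only [Finsupp.add_apply, mapDomain_add_apply, fullExp_apply]
  split_ifs <;> omega

/-- The structural properties of low-defect polynomials that govern the nesting order. -/
structure NestedShape (r : ℕ) (f : MvPolynomial ℕ ℤ) : Prop where
  coeff_nonneg : ∀ m, 0 ≤ f.coeff m
  coeff_zero_pos : 0 < f.coeff 0
  leadCoeff_pos : 0 < f.coeff (fullExp r)
  eq_zero_of_le : ∀ m ∈ f.support, ∀ i, r ≤ i → m i = 0
  le_one : ∀ m ∈ f.support, ∀ i, m i ≤ 1
  antisymm : ∀ i < r, ∀ j < r, NestLe f i j → NestLe f j i → i = j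

theorem NestedShape.fullExp_mem {r : ℕ} {f : MvPolynomial ℕ ℤ} (h : NestedShape r f) :
    fullExp r ∈ f.support := MvPolynomial.mem_support_iff.2 h.leadCoeff_pos.ne'

theorem NestedShape.zero_mem {r : ℕ} {f : MvPolynomial ℕ ℤ} (h : NestedShape r f) :
    0 ∈ f.support := MvPolynomial.mem_support_iff.2 h.coeff_zero_pos.ne'

section Product

variable {r₁ : ℕ} {f₁ f₂ : MvPolynomial ℕ ℤ}

theorem exists_of_mem_support_mul_rename {m : ℕ →₀ ℕ}
    (hm : m ∈ (f₁ * MvPolynomial.rename (· + r₁) f₂).support) :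
    ∃ m₁ ∈ f₁.support, ∃ m₂ ∈ f₂.support, m = m₁ + m₂.mapDomain (· + r₁) := by
  classical
  obtain ⟨m₁, h₁, m', h', rfl⟩ := Finset.mem_add.1 (MvPolynomial.support_mul _ _ hm)
  rw [MvPolynomial.support_rename_of_injective (add_left_injective r₁)] at h'
  obtain ⟨m₂, h₂, rfl⟩ := Finset.mem_image.1 h'
  exact ⟨m₁, h₁, m₂, h₂, rfl⟩

theorem coeff_mul_rename (h₁ : ∀ m ∈ f₁.support, ∀ i, r₁ ≤ i → m i = 0)
    {m₁ : ℕ →₀ ℕ} (hm₁ : ∀ i, r₁ ≤ i → m₁ i = 0) (m₂ : ℕ →₀ ℕ) :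
    (f₁ * MvPolynomial.rename (· + r₁) f₂).coeff (m₁ + m₂.mapDomain (· + r₁)) =
      f₁.coeff m₁ * f₂.coeff m₂ := by
  classical
  have hinj := add_left_injective r₁
  rw [MvPolynomial.coeff_mul, Finset.sum_eq_single (m₁, m₂.mapDomain (· + r₁)),
    MvPolynomial.coeff_rename_mapDomain _ hinj]
  · rintro ⟨a, b⟩ hab hne
    rw [Finset.HasAntidiagonal.mem_antidiagonal] at hab
    by_contra hprod
    have ha : a ∈ f₁.support := MvPolynomial.mem_support_iff.2 (left_ne_zero_of_mul hprod)
    have hb : b ∈ (MvPolynomial.rename (· + r₁) f₂).support :=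
      MvPolynomial.mem_support_iff.2 (right_ne_zero_of_mul hprod)
    rw [MvPolynomial.support_rename_of_injective hinj] at hb
    obtain ⟨b', -, rfl⟩ := Finset.mem_image.1 hb
    refine hne (Prod.ext ?_ ?_) <;> ext i <;>
    · have hi := DFunLike.congr_fun hab i
      have hai := h₁ a ha i
      have hmi := hm₁ i
      simp only [Finsupp.add_apply, mapDomain_add_apply] at hi ⊢
      split_ifs at hi ⊢ <;> simp_all
  · simp

theorem NestedShape.add_mapDomain_mem (h₁ : NestedShape r₁ f₁) {m₁ m₂ : ℕ →₀ ℕ}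
    (hm₁ : m₁ ∈ f₁.support) (hm₂ : m₂ ∈ f₂.support) :
    m₁ + m₂.mapDomain (· + r₁) ∈ (f₁ * MvPolynomial.rename (· + r₁) f₂).support := by
  rw [MvPolynomial.mem_support_iff,
    coeff_mul_rename h₁.eq_zero_of_le (h₁.eq_zero_of_le _ hm₁)]
  exact mul_ne_zero (MvPolynomial.mem_support_iff.1 hm₁) (MvPolynomial.mem_support_iff.1 hm₂)

theorem NestedShape.nestLe_mul_left (h₁ : NestedShape r₁ f₁) {r₂ : ℕ} (h₂ : NestedShape r₂ f₂)
    {i j : ℕ} (hi : i < r₁) (hj : j < r₁) :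
    NestLe (f₁ * MvPolynomial.rename (· + r₁) f₂) i j ↔ NestLe f₁ i j := by
  constructor
  · intro h m hm hmi
    have := h _ (h₁.add_mapDomain_mem hm h₂.zero_mem)
    simp only [Finsupp.mapDomain_zero, add_zero] at this
    exact this hmi
  · intro h m hm hmi
    obtain ⟨m₁, hm₁, m₂, -, rfl⟩ := exists_of_mem_support_mul_rename hm
    simp only [Finsupp.add_apply, mapDomain_add_apply, hi.not_ge, hj.not_ge, if_false,
      add_zero] at hmi ⊢
    exact h m₁ hm₁ hmi

theorem NestedShape.nestLe_mul_right (h₁ : NestedShape r₁ f₁) {i j : ℕ} :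
    NestLe (f₁ * MvPolynomial.rename (· + r₁) f₂) (r₁ + i) (r₁ + j) ↔ NestLe f₂ i j := by
  constructor
  · intro h m hm hmi
    have := h _ (h₁.add_mapDomain_mem h₁.zero_mem hm)
    simp only [mapDomain_add_apply,
      Nat.le_add_right, if_true, Nat.add_sub_cancel_left, zero_add] at this
    exact this hmi
  · intro h m hm hmi
    obtain ⟨m₁, hm₁, m₂, hm₂, rfl⟩ := exists_of_mem_support_mul_rename hm
    simp only [Finsupp.add_apply, mapDomain_add_apply, Nat.le_add_right, if_true,
      Nat.add_sub_cancel_left, h₁.eq_zero_of_le _ hm₁ _ (Nat.le_add_right r₁ _),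
      zero_add] at hmi ⊢
    exact h m₂ hm₂ hmi

theorem NestedShape.mul (h₁ : NestedShape r₁ f₁) {r₂ : ℕ} (h₂ : NestedShape r₂ f₂) :
    NestedShape (r₁ + r₂) (f₁ * MvPolynomial.rename (· + r₁) f₂) where
  coeff_nonneg m := by
    by_contra hneg
    have hm : m ∈ (f₁ * MvPolynomial.rename (· + r₁) f₂).support :=
      MvPolynomial.mem_support_iff.2 fun h => hneg h.ge
    obtain ⟨m₁, hm₁, m₂, -, rfl⟩ := exists_of_mem_support_mul_rename hm
    rw [coeff_mul_rename h₁.eq_zero_of_le (h₁.eq_zero_of_le _ hm₁)] at hneg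
    exact hneg (mul_nonneg (h₁.coeff_nonneg _) (h₂.coeff_nonneg _))
  coeff_zero_pos := by
    have := coeff_mul_rename (f₂ := f₂) h₁.eq_zero_of_le (m₁ := 0) (by simp) 0
    simp only [Finsupp.mapDomain_zero, add_zero] at this
    rw [this]
    exact mul_pos h₁.coeff_zero_pos h₂.coeff_zero_pos
  leadCoeff_pos := by
    rw [fullExp_add, coeff_mul_rename h₁.eq_zero_of_le (h₁.eq_zero_of_le _ h₁.fullExp_mem)]
    exact mul_pos h₁.leadCoeff_pos h₂.leadCoeff_pos
  eq_zero_of_le m hm i hi := by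
    obtain ⟨m₁, hm₁, m₂, hm₂, rfl⟩ := exists_of_mem_support_mul_rename hm
    rw [Finsupp.add_apply, mapDomain_add_apply, h₁.eq_zero_of_le _ hm₁ _ (by omega),
      h₂.eq_zero_of_le _ hm₂ _ (by omega)]
    simp
  le_one m hm i := by
    obtain ⟨m₁, hm₁, m₂, hm₂, rfl⟩ := exists_of_mem_support_mul_rename hm
    rw [Finsupp.add_apply, mapDomain_add_apply]
    split_ifs with hi
    · rw [h₁.eq_zero_of_le _ hm₁ _ hi, zero_add]
      exact h₂.le_one _ hm₂ _
    · exact h₁.le_one _ hm₁ _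
  antisymm i hi j hj hij hji := by
    have cross : ∀ a b, a < r₁ → r₁ ≤ b →
        ¬ NestLe (f₁ * MvPolynomial.rename (· + r₁) f₂) a b := by
      intro a b ha hb h
      have := h _ (h₁.add_mapDomain_mem h₁.fullExp_mem h₂.zero_mem)
      simp [fullExp_apply, ha, hb.not_gt] at this
    rcases lt_or_ge i r₁ with hi₁ | hi₁ <;> rcases lt_or_ge j r₁ with hj₁ | hj₁
    · exact h₁.antisymm i hi₁ j hj₁ ((h₁.nestLe_mul_left h₂ hi₁ hj₁).1 hij)
        ((h₁.nestLe_mul_left h₂ hj₁ hi₁).1 hji)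
    · exact (cross i j hi₁ hj₁ hij).elim
    · exact (cross j i hj₁ hi₁ hji).elim
    · obtain ⟨i, rfl⟩ := Nat.exists_eq_add_of_le hi₁
      obtain ⟨j, rfl⟩ := Nat.exists_eq_add_of_le hj₁
      rw [h₂.antisymm i (by omega) j (by omega) (h₁.nestLe_mul_right.1 hij)
        (h₁.nestLe_mul_right.1 hji)]

end Product

section Step

variable {r : ℕ} {f : MvPolynomial ℕ ℤ}

theorem coeff_step_add_single (c : ℤ) (m : ℕ →₀ ℕ) :
    (f * MvPolynomial.X r + MvPolynomial.C c).coeff (m + Finsupp.single r 1) = f.coeff m := by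
  classical
  have : (0 : ℕ →₀ ℕ) ≠ m + Finsupp.single r 1 := fun h => by
    simpa using DFunLike.congr_fun h r
  rw [MvPolynomial.coeff_add, MvPolynomial.coeff_mul_X, MvPolynomial.coeff_C, if_neg this,
    add_zero]

theorem coeff_step_zero (c : ℤ) :
    (f * MvPolynomial.X r + MvPolynomial.C c).coeff 0 = c := by
  classical
  rw [MvPolynomial.coeff_add, MvPolynomial.coeff_C, MvPolynomial.coeff_mul_X']
  simp

theorem eq_zero_or_exists_of_mem_support_step {c : ℤ} {m : ℕ →₀ ℕ}
    (hm : m ∈ (f * MvPolynomial.X r + MvPolynomial.C c).support) :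
    m = 0 ∨ ∃ m' ∈ f.support, m = m' + Finsupp.single r 1 := by
  classical
  rw [MvPolynomial.mem_support_iff, MvPolynomial.coeff_add, MvPolynomial.coeff_C,
    MvPolynomial.coeff_mul_X'] at hm
  by_cases h0 : m = 0
  · exact .inl h0
  · rw [if_neg (Ne.symm h0), add_zero] at hm
    split_ifs at hm with hr
    · refine .inr ⟨_, MvPolynomial.mem_support_iff.2 hm, ?_⟩
      rw [tsub_add_cancel_of_le]
      simpa [Nat.one_le_iff_ne_zero] using hr
    · exact absurd rfl hm

theorem add_single_mem_support_step (c : ℤ) {m : ℕ →₀ ℕ} (hm : m ∈ f.support) :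
    m + Finsupp.single r 1 ∈ (f * MvPolynomial.X r + MvPolynomial.C c).support := by
  rw [MvPolynomial.mem_support_iff, coeff_step_add_single]
  exact MvPolynomial.mem_support_iff.1 hm

theorem nestLe_step (c : ℤ) {i j : ℕ} (hi : i < r) (hj : j < r) :
    NestLe (f * MvPolynomial.X r + MvPolynomial.C c) i j ↔ NestLe f i j := by
  constructor
  · intro h m hm
    simpa [hi.ne', hj.ne', Finsupp.single_apply] using h _ (add_single_mem_support_step c hm)
  · intro h m hm
    obtain rfl | ⟨m', hm', rfl⟩ := eq_zero_or_exists_of_mem_support_step hm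
    · simp
    · simpa [hi.ne', hj.ne', Finsupp.single_apply] using h m' hm'

theorem NestedShape.not_nestLe_step (h : NestedShape r f) (c : ℤ) {j : ℕ} (hj : j < r) :
    ¬ NestLe (f * MvPolynomial.X r + MvPolynomial.C c) r j := fun hrj => by
  simpa [hj.ne'] using hrj _ (add_single_mem_support_step c h.zero_mem)

theorem nestLe_step_right (c : ℤ) (j : ℕ) :
    NestLe (f * MvPolynomial.X r + MvPolynomial.C c) j r := by
  intro m hm
  obtain rfl | ⟨m', -, rfl⟩ := eq_zero_or_exists_of_mem_support_step hm <;> simp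

theorem NestedShape.step (h : NestedShape r f) {c : ℤ} (hc : 0 < c) :
    NestedShape (r + 1) (f * MvPolynomial.X r + MvPolynomial.C c) where
  coeff_nonneg m := by
    by_contra hneg
    have hm : m ∈ (f * MvPolynomial.X r + MvPolynomial.C c).support :=
      MvPolynomial.mem_support_iff.2 fun h => hneg h.ge
    obtain rfl | ⟨m', -, rfl⟩ := eq_zero_or_exists_of_mem_support_step hm
    · exact hneg (by rw [coeff_step_zero]; exact hc.le)
    · exact hneg (by rw [coeff_step_add_single]; exact h.coeff_nonneg _)
  coeff_zero_pos := by rwa [coeff_step_zero]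
  leadCoeff_pos := by
    rw [fullExp_succ, coeff_step_add_single]
    exact h.leadCoeff_pos
  eq_zero_of_le m hm i hi := by
    obtain rfl | ⟨m', hm', rfl⟩ := eq_zero_or_exists_of_mem_support_step hm
    · simp
    · simp [h.eq_zero_of_le m' hm' i (by omega), show r ≠ i by omega]
  le_one m hm i := by
    obtain rfl | ⟨m', hm', rfl⟩ := eq_zero_or_exists_of_mem_support_step hm
    · simp
    · by_cases hi : i = r
      · subst hi
        simp [h.eq_zero_of_le m' hm' i le_rfl]
      · simpa [hi, Finsupp.single_apply, Ne.symm hi] using h.le_one m' hm' i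
  antisymm i hi j hj hij hji := by
    rcases (Nat.lt_succ_iff_lt_or_eq.1 hi) with hi | rfl <;>
      rcases (Nat.lt_succ_iff_lt_or_eq.1 hj) with hj | rfl
    · exact h.antisymm i hi j hj ((nestLe_step c hi hj).1 hij) ((nestLe_step c hj hi).1 hji)
    · exact (h.not_nestLe_step c hi hji).elim
    · exact (h.not_nestLe_step c hj hij).elim
    · rfl

end Step

theorem LDP.nestedShape {r : ℕ} {f : MvPolynomial ℕ ℤ} {C : ℕ} (h : LDP r f C) :
    NestedShape r f := by
  classical
  induction h with
  | const k C hk hC =>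
    have supp : ∀ m ∈ (MvPolynomial.C (k : ℤ) : MvPolynomial ℕ ℤ).support, m = 0 := by
      intro m hm
      by_contra hne
      rw [MvPolynomial.mem_support_iff, MvPolynomial.coeff_C, if_neg (Ne.symm hne)] at hm
      exact hm rfl
    exact
      { coeff_nonneg := fun m => by rw [MvPolynomial.coeff_C]; split_ifs <;> simp
        coeff_zero_pos := by rw [MvPolynomial.coeff_C]; simpa
        leadCoeff_pos := by rw [MvPolynomial.coeff_C]; simpa [fullExp]
        eq_zero_of_le := fun m hm i _ => by simp [supp m hm]
        le_one := fun m hm i => by simp [supp m hm]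
        antisymm := fun i hi => by omega }
  | mul _ _ h₁ h₂ => exact h₁.mul h₂
  | step c D hc hD _ h => exact h.step (by exact_mod_cast hc)

theorem LDP.zero_deg {r : ℕ} {f : MvPolynomial ℕ ℤ} {C : ℕ} (h : LDP r f C) (hr : r = 0) :
    ∃ k : ℕ, 0 < k ∧ cpx k ≤ C ∧ f = MvPolynomial.C (k : ℤ) := by
  induction h with
  | const k C hk hC => exact ⟨k, hk, hC, rfl⟩
  | mul _ _ ih₁ ih₂ =>
    obtain ⟨k₁, hk₁, hC₁, rfl⟩ := ih₁ (by omega)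
    obtain ⟨k₂, hk₂, hC₂, rfl⟩ := ih₂ (by omega)
    refine ⟨k₁ * k₂, Nat.mul_pos hk₁ hk₂, (cpx_mul_le hk₁ hk₂).trans (by omega), ?_⟩
    rw [MvPolynomial.rename_C, ← MvPolynomial.C_mul, Nat.cast_mul]
  | step => omega

theorem LDP.leadCoeff_pow_le {r : ℕ} {f : MvPolynomial ℕ ℤ} {C : ℕ} (h : LDP r f C) :
    f.coeff (fullExp r) ^ 3 * 3 ^ r ≤ 3 ^ C := by
  induction h with
  | const k C hk hC =>
    have h₁ : k ^ 3 ≤ 3 ^ C :=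
      (cpxW_cpx hk).pow_three_le.trans (Nat.pow_le_pow_right (by norm_num) hC)
    have h₂ : fullExp 0 = 0 := by simp [fullExp]
    rw [h₂, MvPolynomial.coeff_C, if_pos rfl, pow_zero, mul_one]
    exact_mod_cast h₁
  | mul h₁ h₂ ih₁ ih₂ =>
    have hs₁ := h₁.nestedShape
    have hs₂ := h₂.nestedShape
    rw [fullExp_add, coeff_mul_rename hs₁.eq_zero_of_le (hs₁.eq_zero_of_le _ hs₁.fullExp_mem),
      mul_pow, pow_add, pow_add, mul_mul_mul_comm]
    exact mul_le_mul ih₁ ih₂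
      (mul_nonneg (pow_nonneg hs₂.leadCoeff_pos.le _) (by positivity)) (by positivity)
  | step c D hc hD _ ih =>
    rw [fullExp_succ, coeff_step_add_single, pow_succ (3 : ℤ), pow_add, ← mul_assoc]
    have h₃ : (3 : ℤ) ≤ 3 ^ D := by
      simpa using pow_le_pow_right₀ (by norm_num : (1 : ℤ) ≤ 3) ((one_le_cpx hc).trans hD)
    exact mul_le_mul ih h₃ (by norm_num) (by positivity)

theorem LDP.aeval_congr {r : ℕ} {f : MvPolynomial ℕ ℤ} {C : ℕ} (h : LDP r f C)
    {φ ψ : ℕ → MvPolynomial ℕ ℤ} (hφ : ∀ j < r, φ j = ψ j) :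
    MvPolynomial.aeval φ f = MvPolynomial.aeval ψ f := by
  induction h generalizing φ ψ with
  | const => simp
  | mul _ _ ih₁ ih₂ =>
    rw [map_mul, map_mul, MvPolynomial.aeval_rename, MvPolynomial.aeval_rename,
      ih₁ fun j hj => hφ j (Nat.lt_add_right _ hj)]
    congr 1
    exact ih₂ fun j hj => hφ (j + _) (by omega)
  | @step r _ _ _ _ _ _ _ ih =>
    rw [map_add, map_add, map_mul, map_mul, MvPolynomial.aeval_X, MvPolynomial.aeval_X,
      ih fun j hj => hφ j (by omega), hφ r (by omega), MvPolynomial.aeval_C,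
      MvPolynomial.aeval_C]

theorem LDP.truncAt {r : ℕ} {f : MvPolynomial ℕ ℤ} {C : ℕ} (h : LDP r f C) {i : ℕ}
    (hi : IsMinVar r f i) (k : ℕ) : LDP (r - 1) (truncAt f i k) (C + 3 * k) := by
  induction h generalizing i with
  | const => exact absurd hi.1 (by omega)
  | @mul r₁ r₂ f₁ f₂ C₁ C₂ h₁ h₂ ih₁ ih₂ =>
    have hs₁ := h₁.nestedShape
    have hs₂ := h₂.nestedShape
    rcases lt_or_ge i r₁ with hir | hir
    · have hi₁ : IsMinVar r₁ f₁ i := ⟨hir, fun j hj hji => (hs₁.nestLe_mul_left hs₂ hir hj).1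
        (hi.2 j (by omega) ((hs₁.nestLe_mul_left hs₂ hj hir).2 hji))⟩
      have key := (ih₁ hi₁).mul h₂
      rw [add_right_comm, ← Nat.sub_add_comm (by omega : 1 ≤ r₁)] at key
      convert key using 1
      rw [_root_.truncAt, map_mul, MvPolynomial.aeval_rename, MvPolynomial.rename_eq_aeval]
      congr 2
      congr 1
      funext j
      have h1 : ¬ j + r₁ < i := by omega
      have h2 : j + r₁ ≠ i := by omega
      simp only [Function.comp_apply, h1, h2, if_false]
      congr 1
      omega
    · obtain ⟨i, rfl⟩ := Nat.exists_eq_add_of_le hir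
      have hir₂ : i < r₂ := by have := hi.1; omega
      have hi₂ : IsMinVar r₂ f₂ i := ⟨hir₂, fun j hj hji => hs₁.nestLe_mul_right.1
        (hi.2 (r₁ + j) (by omega) (hs₁.nestLe_mul_right.2 hji))⟩
      have key := h₁.mul (ih₂ hi₂)
      rw [← Nat.add_sub_assoc (by omega), ← add_assoc] at key
      convert key using 1
      rw [_root_.truncAt, map_mul, MvPolynomial.aeval_rename,
        h₁.aeval_congr (ψ := MvPolynomial.X) (fun j hj => by simp [hj.trans_le hir]),
        MvPolynomial.aeval_X_left_apply, _root_.truncAt, ← AlgHom.comp_apply,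
        MvPolynomial.comp_aeval]
      congr 2
      congr 1
      funext j
      rcases lt_trichotomy j i with hj | rfl | hj
      · simp [hj, add_comm]
      · simp only [Function.comp_apply, add_comm, lt_irrefl, if_false, if_true,
          MvPolynomial.rename_C]
      · have h1 : ¬ j + r₁ < r₁ + i := by omega
        have h2 : j + r₁ ≠ r₁ + i := by omega
        simp only [Function.comp_apply, h1, h2, hj.not_gt, hj.ne', if_false,
          MvPolynomial.rename_X]
        congr 1
        omega
  | @step r f C c D hc hD h ih =>
    have hs := h.nestedShape
    rcases Nat.lt_succ_iff_lt_or_eq.1 hi.1 with hir | rfl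
    · have hi' : IsMinVar r f i := ⟨hir, fun j hj hji => (nestLe_step c hir hj).1
        (hi.2 j (by omega) ((nestLe_step c hj hir).2 hji))⟩
      have key := (ih hi').step c D hc hD
      rw [add_right_comm, Nat.sub_add_cancel (by omega : 1 ≤ r)] at key
      rw [Nat.add_sub_cancel]
      convert key using 1
      rw [_root_.truncAt, map_add, map_mul, MvPolynomial.aeval_X, MvPolynomial.aeval_C,
        if_neg (by omega), if_neg (by omega)]
      rfl
    · obtain rfl : i = 0 := by
        by_contra hne
        have hpos : 0 < i := Nat.pos_of_ne_zero hne
        exact hs.not_nestLe_step c hpos (hi.2 0 (by omega) (nestLe_step_right c 0))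
      obtain ⟨a, ha, haC, rfl⟩ := h.zero_deg rfl
      have key := LDP.const (a * 3 ^ k + c) (C + D + 3 * k) (by positivity)
        ((cpx_mul_three_pow_add_le ha hc k).trans (by omega))
      convert key using 1
      rw [_root_.truncAt, map_add, map_mul, MvPolynomial.aeval_X, MvPolynomial.aeval_C,
        MvPolynomial.aeval_C]
      simp

/-- The increasing enumeration of the indices other than `i`. -/
def deleteIdx (i j : ℕ) : ℕ := if j < i then j else j + 1

theorem deleteIdx_injective (i : ℕ) : Function.Injective (deleteIdx i) := by
  intro a b h
  unfold deleteIdx at h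
  split_ifs at h <;> omega

theorem truncAt_monomial (i k : ℕ) (d : ℕ →₀ ℕ) (c : ℤ) :
    ∃ c', truncAt (MvPolynomial.monomial d c) i k =
      MvPolynomial.monomial (d.comapDomain (deleteIdx i) (deleteIdx_injective i).injOn) c' := by
  induction d using Finsupp.induction_linear generalizing c with
  | zero => exact ⟨c, by simp [truncAt]⟩
  | add d₁ d₂ h₁ h₂ =>
    obtain ⟨c₁, h₁⟩ := h₁ c
    obtain ⟨c₂, h₂⟩ := h₂ 1
    refine ⟨c₁ * c₂, ?_⟩
    rw [Finsupp.comapDomain_add_of_injective (deleteIdx_injective i),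
      ← MvPolynomial.monomial_mul, ← h₁, ← h₂, truncAt, truncAt, truncAt, ← map_mul,
      MvPolynomial.monomial_mul, mul_one]
  | single j n =>
    have hcomap : ∀ j', deleteIdx i j' = j →
        (Finsupp.single j n).comapDomain (deleteIdx i) (deleteIdx_injective i).injOn =
          Finsupp.single j' n := by
      rintro j' rfl
      exact Finsupp.comapDomain_single _ _ _ _
    have htrunc : truncAt (MvPolynomial.monomial (Finsupp.single j n) c) i k =
        MvPolynomial.C c * (if j < i then MvPolynomial.X j
          else if j = i then MvPolynomial.C ((3 : ℤ) ^ k) else MvPolynomial.X (j - 1)) ^ n := by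
      rw [truncAt, MvPolynomial.aeval_monomial, MvPolynomial.algebraMap_eq]
      congr 1
      exact Finsupp.prod_single_index (pow_zero _)
    rw [htrunc]
    rcases lt_trichotomy j i with hj | rfl | hj
    · refine ⟨c, ?_⟩
      rw [hcomap j (by simp [deleteIdx, hj]), if_pos hj, MvPolynomial.C_mul_X_pow_eq_monomial]
    · refine ⟨c * (3 ^ k) ^ n, ?_⟩
      have : (Finsupp.single j n).comapDomain (deleteIdx j) (deleteIdx_injective j).injOn = 0 := by
        ext l
        have : j ≠ deleteIdx j l := by unfold deleteIdx; split_ifs <;> omega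
        simp [this]
      rw [this, if_neg (lt_irrefl _), if_pos rfl, ← MvPolynomial.C_pow, ← MvPolynomial.C_mul]
      rfl
    · refine ⟨c, ?_⟩
      rw [hcomap (j - 1) (by unfold deleteIdx; split_ifs <;> omega), if_neg hj.not_gt,
        if_neg hj.ne', MvPolynomial.C_mul_X_pow_eq_monomial]

theorem exists_of_mem_support_truncAt {f : MvPolynomial ℕ ℤ} {i k : ℕ} {m : ℕ →₀ ℕ}
    (hm : m ∈ (truncAt f i k).support) :
    ∃ d ∈ f.support, ∀ j, m j = d (deleteIdx i j) := by
  rw [MvPolynomial.mem_support_iff] at hm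
  have hsum : truncAt f i k =
      ∑ d ∈ f.support, truncAt (MvPolynomial.monomial d (f.coeff d)) i k := by
    conv_lhs => rw [f.as_sum]
    simp only [truncAt, map_sum]
  rw [hsum, MvPolynomial.coeff_sum] at hm
  obtain ⟨d, hd, hne⟩ := Finset.exists_ne_zero_of_sum_ne_zero hm
  obtain ⟨c', hc'⟩ := truncAt_monomial i k d (f.coeff d)
  rw [hc', MvPolynomial.coeff_monomial] at hne
  split_ifs at hne with h
  · exact ⟨d, hd, fun j => by rw [← h, Finsupp.comapDomain_apply]⟩
  · exact absurd rfl hne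

theorem NestLe.truncAt {f : MvPolynomial ℕ ℤ} {i j l : ℕ} (k : ℕ)
    (h : NestLe f (deleteIdx i j) (deleteIdx i l)) : NestLe (truncAt f i k) j l := by
  intro m hm
  obtain ⟨d, hd, hmd⟩ := exists_of_mem_support_truncAt hm
  rw [hmd, hmd]
  exact h d hd

theorem exists_isMinVar_nestLe {r : ℕ} (f : MvPolynomial ℕ ℤ) {i : ℕ} (hi : i < r) :
    ∃ j, IsMinVar r f j ∧ NestLe f j i := by
  classical
  induction hn : ((Finset.range r).filter (NestLe f · i)).card
    using Nat.strong_induction_on generalizing i with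
  | _ n ih =>
    by_cases hmin : IsMinVar r f i
    · exact ⟨i, hmin, fun _ _ h => h⟩
    · have : ∃ j < r, NestLe f j i ∧ ¬ NestLe f i j := by
        by_contra! h
        exact hmin ⟨hi, h⟩
      obtain ⟨j, hj, hji, hij⟩ := this
      have hlt : ((Finset.range r).filter (NestLe f · j)).card < n := by
        rw [← hn]
        refine Finset.card_lt_card (Finset.ssubset_iff_of_subset ?_ |>.2 ⟨i, ?_, ?_⟩)
        · intro l hl
          rw [Finset.mem_filter] at hl ⊢
          exact ⟨hl.1, fun m hm h => hji m hm (hl.2 m hm h)⟩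
        · exact Finset.mem_filter.2 ⟨Finset.mem_range.2 hi, fun _ _ h => h⟩
        · exact fun h => hij (Finset.mem_filter.1 h).2
      obtain ⟨l, hl, hlj⟩ := ih _ hlt hj rfl
      exact ⟨l, hl, fun m hm h => hji m hm (hlj m hm h)⟩

section Evaluation

variable {r : ℕ} {f : MvPolynomial ℕ ℤ}

theorem NestedShape.eval3_eq (h : NestedShape r f) (k : ℕ → ℕ) :
    eval3 r f k =
      ∑ m ∈ f.support, f.coeff m * ∏ i ∈ Finset.range r, ((3 : ℤ) ^ k i) ^ m i := by
  rw [eval3, MvPolynomial.eval_eq]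
  refine Finset.sum_congr rfl fun m hm => ?_
  congr 1
  have hsub : m.support ⊆ Finset.range r := fun i hi => by
    by_contra hir
    exact Finsupp.mem_support_iff.1 hi (h.eq_zero_of_le m hm i (by simpa using hir))
  rw [← Finset.prod_subset hsub fun i _ hi => by simp [Finsupp.notMem_support_iff.1 hi]]
  exact Finset.prod_congr rfl fun i hi => by rw [if_pos (Finset.mem_range.1 (hsub hi))]

theorem prod_pow_fullExp (r : ℕ) (k : ℕ → ℕ) :
    ∏ i ∈ Finset.range r, ((3 : ℤ) ^ k i) ^ fullExp r i = 3 ^ ∑ i ∈ Finset.range r, k i := by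
  rw [← Finset.prod_pow_eq_pow_sum]
  refine Finset.prod_congr rfl fun i hi => ?_
  rw [fullExp_apply, if_pos (Finset.mem_range.1 hi), pow_one]

theorem NestedShape.lead_lt_eval3 (h : NestedShape r f) (hr : 0 < r) (k : ℕ → ℕ) :
    leadCoeff r f * 3 ^ ∑ i ∈ Finset.range r, k i < eval3 r f k := by
  classical
  have hne : fullExp r ≠ 0 := fun h0 => by
    simpa [fullExp_apply, hr] using DFunLike.congr_fun h0 0
  rw [h.eval3_eq, ← Finset.add_sum_erase _ _ h.fullExp_mem, prod_pow_fullExp]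
  refine lt_add_of_pos_right _ (Finset.sum_pos' (fun m _ => ?_) ⟨0, ?_, ?_⟩)
  · exact mul_nonneg (h.coeff_nonneg m) (Finset.prod_nonneg fun i _ => by positivity)
  · exact Finset.mem_erase.2 ⟨hne.symm, h.zero_mem⟩
  · simpa using h.coeff_zero_pos

theorem NestedShape.eval3_pos (h : NestedShape r f) (k : ℕ → ℕ) : 0 < eval3 r f k := by
  rw [h.eval3_eq]
  refine Finset.sum_pos' (fun m _ => ?_) ⟨0, h.zero_mem, by simpa using h.coeff_zero_pos⟩
  exact mul_nonneg (h.coeff_nonneg m) (Finset.prod_nonneg fun i _ => by positivity)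

theorem NestedShape.eval3_le (h : NestedShape r f) {K : ℕ} {k : ℕ → ℕ}
    (hk : ∀ j, IsMinVar r f j → K ≤ k j) :
    3 ^ K * eval3 r f k ≤ 3 ^ (∑ i ∈ Finset.range r, k i) *
      (3 ^ K * leadCoeff r f + ∑ m ∈ f.support, f.coeff m) := by
  classical
  have hmono : ∀ m ∈ f.support, m ≠ fullExp r →
      3 ^ K * ∏ i ∈ Finset.range r, ((3 : ℤ) ^ k i) ^ m i ≤
        3 ^ ∑ i ∈ Finset.range r, k i := by
    intro m hm hne
    obtain ⟨i, hi, hmi⟩ : ∃ i < r, m i = 0 := by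
      by_contra! hall
      refine hne (Finsupp.ext fun i => ?_)
      rw [fullExp_apply]
      split_ifs with hi
      · exact le_antisymm (h.le_one m hm i) (Nat.one_le_iff_ne_zero.2 (hall i hi))
      · exact h.eq_zero_of_le m hm i (not_lt.1 hi)
    obtain ⟨j, hj, hji⟩ := exists_isMinVar_nestLe f hi
    have hmj : m j = 0 := by
      by_contra hmj
      exact hji m hm hmj hmi
    have hjr := Finset.mem_range.2 hj.1
    rw [← Finset.prod_pow_eq_pow_sum, ← Finset.mul_prod_erase _ _ hjr,
      ← Finset.mul_prod_erase _ (fun i => (3 : ℤ) ^ k i) hjr, hmj, pow_zero, one_mul]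
    refine mul_le_mul (pow_le_pow_right₀ (by norm_num) (hk j hj))
      (Finset.prod_le_prod (fun i _ => by positivity) fun i _ => ?_)
      (Finset.prod_nonneg fun i _ => by positivity) (by positivity)
    simpa using pow_le_pow_right₀ (one_le_pow₀ (by norm_num : (1 : ℤ) ≤ 3)) (h.le_one m hm i)
  rw [h.eval3_eq, ← Finset.add_sum_erase _ _ h.fullExp_mem, prod_pow_fullExp, mul_add, mul_add,
    Finset.mul_sum, Finset.mul_sum]
  refine add_le_add (le_of_eq (by rw [leadCoeff, fullExp]; ring)) ?_
  calc ∑ m ∈ f.support.erase (fullExp r),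
        3 ^ K * (f.coeff m * ∏ i ∈ Finset.range r, ((3 : ℤ) ^ k i) ^ m i)
      ≤ ∑ m ∈ f.support.erase (fullExp r), 3 ^ (∑ i ∈ Finset.range r, k i) * f.coeff m := by
        refine Finset.sum_le_sum fun m hm => ?_
        rw [mul_left_comm, mul_comm _ (f.coeff m)]
        exact mul_le_mul_of_nonneg_left
          (hmono m (Finset.mem_of_mem_erase hm) (Finset.ne_of_mem_erase hm)) (h.coeff_nonneg m)
    _ ≤ ∑ m ∈ f.support, 3 ^ (∑ i ∈ Finset.range r, k i) * f.coeff m :=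
        Finset.sum_le_sum_of_subset_of_nonneg (Finset.erase_subset _ _)
          fun m _ _ => mul_nonneg (by positivity) (h.coeff_nonneg m)

theorem NestedShape.dftF_lt_pairDft (h : NestedShape r f) (hr : 0 < r) (C : ℕ) (k : ℕ → ℕ) :
    dftF r f C k < pairDft r f C := by
  have ha : (0 : ℝ) < leadCoeff r f := by exact_mod_cast h.leadCoeff_pos
  have hlt : (leadCoeff r f : ℝ) * 3 ^ (∑ i ∈ Finset.range r, k i) < eval3 r f k := by
    exact_mod_cast h.lead_lt_eval3 hr k
  have hlog := Real.logb_lt_logb (b := 3) (by norm_num) (by positivity) hlt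
  rw [Real.logb_mul ha.ne' (by positivity), Real.logb_pow, Real.logb_self_eq_one (by norm_num),
    mul_one, Nat.cast_sum] at hlog
  rw [dftF, pairDft]
  linarith

theorem NestedShape.exists_bound (h : NestedShape r f) {C : ℕ} {s : ℝ}
    (hs : s < pairDft r f C) :
    ∃ K : ℕ, ∀ k, dftF r f C k < s → ∃ i, IsMinVar r f i ∧ k i < K := by
  set a : ℝ := (leadCoeff r f : ℝ) with ha_def
  set B : ℝ := ((∑ m ∈ f.support, f.coeff m : ℤ) : ℝ) with hB_def
  have ha : 0 < a := by rw [ha_def]; exact_mod_cast h.leadCoeff_pos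
  have hB : 0 ≤ B := by
    rw [hB_def]
    exact_mod_cast Finset.sum_nonneg fun m _ => h.coeff_nonneg m
  have hlt : a < 3 ^ (((C : ℝ) - s) / 3) := by
    rw [← Real.logb_lt_iff_lt_rpow (by norm_num) ha]
    rw [pairDft] at hs
    linarith
  obtain ⟨K, hK⟩ := pow_unbounded_of_one_lt (B / (3 ^ (((C : ℝ) - s) / 3) - a))
    (by norm_num : (1 : ℝ) < 3)
  refine ⟨K, fun k hk => ?_⟩
  by_contra! hmin
  refine hk.not_ge ?_
  have hle : (3 : ℝ) ^ K * eval3 r f k ≤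
      3 ^ (∑ i ∈ Finset.range r, k i) * (3 ^ K * a + B) := by
    rw [ha_def, hB_def]
    exact_mod_cast h.eval3_le hmin
  have hpos : (0 : ℝ) < eval3 r f k := by exact_mod_cast h.eval3_pos k
  have hK' : 3 ^ K * a + B ≤ (3 : ℝ) ^ K * 3 ^ (((C : ℝ) - s) / 3) := by
    rw [div_lt_iff₀ (sub_pos.2 hlt)] at hK
    linarith
  have heval : (eval3 r f k : ℝ) ≤
      3 ^ (∑ i ∈ Finset.range r, k i) * 3 ^ (((C : ℝ) - s) / 3) := by
    refine le_of_mul_le_mul_left (hle.trans ?_) (by positivity : (0 : ℝ) < 3 ^ K)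
    rw [mul_left_comm]
    exact mul_le_mul_of_nonneg_left hK' (by positivity)
  have hlog := Real.logb_le_logb_of_le (b := 3) (by norm_num) hpos heval
  rw [Real.logb_mul (by positivity) (by positivity), Real.logb_pow,
    Real.logb_self_eq_one (by norm_num), Real.logb_rpow (by norm_num) (by norm_num), mul_one,
    Nat.cast_sum] at hlog
  rw [dftF]
  linarith

theorem LDP.le_pairDft {C : ℕ} (h : LDP r f C) : (r : ℝ) ≤ pairDft r f C := by
  have ha : (0 : ℝ) < leadCoeff r f := by exact_mod_cast h.nestedShape.leadCoeff_pos
  have hle : (leadCoeff r f : ℝ) ^ 3 * 3 ^ r ≤ 3 ^ C := by exact_mod_cast h.leadCoeff_pow_le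
  have hlog := Real.logb_le_logb_of_le (b := 3) (by norm_num) (by positivity) hle
  rw [Real.logb_mul (by positivity) (by positivity), Real.logb_pow, Real.logb_pow, Real.logb_pow,
    Real.logb_self_eq_one (by norm_num)] at hlog
  rw [pairDft]
  push_cast at hlog
  linarith

theorem LDP.dftF_zero_deg {C : ℕ} (h : LDP 0 f C) (k : ℕ → ℕ) : dftF 0 f C k = pairDft 0 f C := by
  obtain ⟨a, -, -, rfl⟩ := h.zero_deg rfl
  have : leadCoeff 0 (MvPolynomial.C (a : ℤ)) = a := by
    rw [leadCoeff, Finset.range_zero, Finset.sum_empty, MvPolynomial.coeff_C, if_pos rfl]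
  rw [dftF, pairDft, this, eval3, MvPolynomial.eval_C]
  simp

end Evaluation

section Insertion

/-- The sequence with `a` inserted at position `i`. -/
def insertAt {α : Type*} (i : ℕ) (a : α) (p : ℕ → α) (j : ℕ) : α :=
  if j < i then p j else if j = i then a else p (j - 1)

variable {α : Type*} (i : ℕ) (a : α) (p : ℕ → α)

theorem insertAt_self : insertAt i a p i = a := by simp [insertAt]

theorem insertAt_deleteIdx (j : ℕ) : insertAt i a p (deleteIdx i j) = p j := by
  unfold insertAt deleteIdx
  split_ifs <;> first | rfl | omega

theorem eq_or_exists_deleteIdx (j : ℕ) : j = i ∨ ∃ j', j = deleteIdx i j' := by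
  unfold deleteIdx
  rcases lt_trichotomy j i with h | h | h
  · exact .inr ⟨j, by rw [if_pos h]⟩
  · exact .inl h
  · exact .inr ⟨j - 1, by split_ifs <;> omega⟩

theorem deleteIdx_lt_succ_iff {r : ℕ} (hi : i < r + 1) (j : ℕ) :
    deleteIdx i j < r + 1 ↔ j < r := by
  unfold deleteIdx
  split_ifs <;> omega

theorem sum_range_succ_deleteIdx {M : Type*} [AddCommMonoid M] {r : ℕ} (hi : i < r + 1)
    (g : ℕ → M) :
    ∑ j ∈ Finset.range (r + 1), g j = g i + ∑ j ∈ Finset.range r, g (deleteIdx i j) := by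
  induction r with
  | zero =>
    obtain rfl : i = 0 := by omega
    simp
  | succ r ih =>
    rcases Nat.lt_succ_iff_lt_or_eq.1 hi with hi' | rfl
    · rw [Finset.sum_range_succ, ih hi', Finset.sum_range_succ _ r, add_assoc]
      congr 3
      rw [deleteIdx, if_neg (by omega)]
    · rw [Finset.sum_range_succ, add_comm]
      congr 1
      refine Finset.sum_congr rfl fun j hj => ?_
      rw [deleteIdx, if_pos (Finset.mem_range.1 hj)]

end Insertion

theorem starCount_eq_sum (r : ℕ) (p : ℕ → Option ℕ) :
    starCount r p = ∑ j ∈ Finset.range r, if p j = none then 1 else 0 :=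
  Finset.card_filter _ _

theorem starCount_insertAt {r i : ℕ} (hi : i < r + 1) (k : ℕ) (p : ℕ → Option ℕ) :
    starCount (r + 1) (insertAt i (some k) p) = starCount r p := by
  rw [starCount_eq_sum, starCount_eq_sum, sum_range_succ_deleteIdx i hi]
  simp [insertAt_self, insertAt_deleteIdx]

theorem sum_getD_insertAt {r i : ℕ} (hi : i < r + 1) (k : ℕ) (p : ℕ → Option ℕ) :
    ∑ j ∈ Finset.range (r + 1), (insertAt i (some k) p j).getD 0 =
      k + ∑ j ∈ Finset.range r, (p j).getD 0 := by
  rw [sum_range_succ_deleteIdx i hi]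
  simp [insertAt_self, insertAt_deleteIdx]

theorem starCount_insertAt_of_le {j i : ℕ} (hj : j ≤ i) (k : ℕ) (p : ℕ → Option ℕ) :
    starCount j (insertAt i (some k) p) = starCount j p := by
  rw [starCount_eq_sum, starCount_eq_sum]
  refine Finset.sum_congr rfl fun l hl => ?_
  rw [insertAt, if_pos ((Finset.mem_range.1 hl).trans_le hj)]

theorem subst3_truncAt (f : MvPolynomial ℕ ℤ) (i k : ℕ) (p : ℕ → Option ℕ) :
    subst3 (truncAt f i k) p = subst3 f (insertAt i (some k) p) := by
  rw [subst3, truncAt, ← AlgHom.comp_apply, MvPolynomial.comp_aeval, subst3]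
  congr 2
  funext j
  rcases lt_trichotomy j i with hj | rfl | hj
  · have h := starCount_insertAt_of_le hj.le k p
    unfold starCount at h
    rw [if_pos hj, MvPolynomial.aeval_X, h, insertAt, if_pos hj]
  · rw [if_neg (lt_irrefl j), if_pos rfl, MvPolynomial.aeval_C, insertAt_self]
    rfl
  · obtain ⟨j, rfl⟩ : ∃ l, j = l + 1 := ⟨j - 1, by omega⟩
    have h := starCount_insertAt hj k p
    unfold starCount at h
    rw [if_neg hj.not_gt, if_neg hj.ne', MvPolynomial.aeval_X, h, insertAt, if_neg hj.not_gt,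
      if_neg hj.ne', Nat.add_sub_cancel]

theorem subst3_none (f : MvPolynomial ℕ ℤ) : subst3 f (fun _ => none) = f := by
  simp [subst3]

theorem starCount_none (r : ℕ) : starCount r (fun _ => none) = r := by simp [starCount]

theorem eval3_truncAt {r i : ℕ} (hi : i < r + 1) (f : MvPolynomial ℕ ℤ) (k : ℕ → ℕ) :
    eval3 r (truncAt f i (k i)) (fun j => k (deleteIdx i j)) = eval3 (r + 1) f k := by
  unfold eval3 truncAt
  rw [← MvPolynomial.coe_aeval_eq_eval, ← MvPolynomial.coe_aeval_eq_eval, RingHom.coe_coe,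
    RingHom.coe_coe, ← AlgHom.comp_apply, MvPolynomial.comp_aeval]
  congr 2
  funext j
  rcases lt_trichotomy j i with hj | rfl | hj
  · have hdel : deleteIdx i j = j := if_pos hj
    simp only [if_pos hj, MvPolynomial.aeval_X, hdel, if_pos (by omega : j < r),
      if_pos (by omega : j < r + 1)]
  · simp [hi]
  · obtain ⟨j, rfl⟩ : ∃ l, j = l + 1 := ⟨j - 1, by omega⟩
    have hdel : deleteIdx i j = j + 1 := if_neg (by omega)
    simp only [if_neg hj.not_gt, if_neg hj.ne', MvPolynomial.aeval_X, Nat.add_sub_cancel, hdel,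
      Nat.add_lt_add_iff_right]

theorem dftF_truncAt {r i : ℕ} (hi : i < r + 1) (f : MvPolynomial ℕ ℤ) (C : ℕ) (k : ℕ → ℕ) :
    dftF r (truncAt f i (k i)) (C + 3 * k i) (fun j => k (deleteIdx i j)) =
      dftF (r + 1) f C k := by
  rw [dftF, dftF, eval3_truncAt hi, sum_range_succ_deleteIdx i hi]
  push_cast
  ring

/-- `T` describes the set of tuples of defect less than `s` for the low-defect pair `(f, C)`
of degree `r` as a finite union of 3-substitutions that are truncations of `(f, C)`. -/
structure TruncationSet (r : ℕ) (f : MvPolynomial ℕ ℤ) (C : ℕ) (s : ℝ)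
    (T : Set (ℕ → Option ℕ)) : Prop where
  finite : T.Finite
  eq_none : ∀ p ∈ T, ∀ j, r ≤ j → p j = none
  dftF_lt_iff : ∀ k : ℕ → ℕ, dftF r f C k < s ↔
    ∃ p ∈ T, ∀ j < r, ∀ m, p j = some m → k j = m
  isTruncation : ∀ p ∈ T,
    (∀ i j, i < r → j < r → NestLe f i j → p j ≠ none → p i ≠ none) ∧
    Relation.ReflTransGen DirectTrunc (r, f, C)
      (starCount r p, subst3 f p, C + 3 * ∑ i ∈ Finset.range r, (p i).getD 0) ∧
    pairDft (starCount r p) (subst3 f p)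
      (C + 3 * ∑ i ∈ Finset.range r, (p i).getD 0) ≤ s ∧
    starCount r p ≤ Nat.floor s ∧
    (starCount r p = 0 →
      pairDft (starCount r p) (subst3 f p)
        (C + 3 * ∑ i ∈ Finset.range r, (p i).getD 0) < s)

theorem forall_insertAt_iff {r i : ℕ} (hi : i < r + 1) (a : ℕ) (p : ℕ → Option ℕ) (k : ℕ → ℕ) :
    (∀ j < r + 1, ∀ m, insertAt i (some a) p j = some m → k j = m) ↔
      k i = a ∧ ∀ j < r, ∀ m, p j = some m → k (deleteIdx i j) = m := by
  constructor
  · intro h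
    refine ⟨h i hi a (insertAt_self ..), fun j hj m hm => ?_⟩
    exact h _ ((deleteIdx_lt_succ_iff i hi j).2 hj) m (by rwa [insertAt_deleteIdx])
  · rintro ⟨rfl, h⟩ j hj m hm
    obtain rfl | ⟨j, rfl⟩ := eq_or_exists_deleteIdx i j
    · rw [insertAt_self] at hm
      exact Option.some.inj hm
    · rw [insertAt_deleteIdx] at hm
      exact h j ((deleteIdx_lt_succ_iff i hi j).1 hj) m hm

theorem NestedShape.downwardClosed_insertAt {r : ℕ} {f : MvPolynomial ℕ ℤ}
    (h : NestedShape (r + 1) f) {i : ℕ} (hi : IsMinVar (r + 1) f i) (k : ℕ) {p : ℕ → Option ℕ}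
    (hp : ∀ j l, j < r → l < r → NestLe (truncAt f i k) j l → p l ≠ none → p j ≠ none)
    {j l : ℕ} (hj : j < r + 1) (hl : l < r + 1) (hjl : NestLe f j l)
    (hpl : insertAt i (some k) p l ≠ none) : insertAt i (some k) p j ≠ none := by
  obtain rfl | ⟨j, rfl⟩ := eq_or_exists_deleteIdx i j
  · simp [insertAt_self]
  obtain rfl | ⟨l, rfl⟩ := eq_or_exists_deleteIdx i l
  · rw [h.antisymm _ hj _ hl hjl (hi.2 _ hj hjl), insertAt_self]
    simp
  · rw [insertAt_deleteIdx] at hpl ⊢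
    exact hp j l ((deleteIdx_lt_succ_iff i hi.1 j).1 hj) ((deleteIdx_lt_succ_iff i hi.1 l).1 hl)
      (hjl.truncAt k) hpl

theorem TruncationSet.biUnion {r : ℕ} {f : MvPolynomial ℕ ℤ} {C : ℕ} {s : ℝ}
    (h : NestedShape (r + 1) f) {K : ℕ}
    (hK : ∀ k, dftF (r + 1) f C k < s → ∃ i, IsMinVar (r + 1) f i ∧ k i < K)
    {T : ℕ → ℕ → Set (ℕ → Option ℕ)}
    (hT : ∀ i k, IsMinVar (r + 1) f i → TruncationSet r (truncAt f i k) (C + 3 * k) s (T i k)) :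
    TruncationSet (r + 1) f C s
      (⋃ i ∈ {i | IsMinVar (r + 1) f i}, ⋃ k ∈ Set.Iio K, insertAt i (some k) '' T i k) where
  finite := ((Set.finite_Iio (r + 1)).subset fun _ hi => hi.1).biUnion fun i hi =>
    (Set.finite_Iio K).biUnion fun k _ => (hT i k hi).finite.image _
  eq_none q hq j hj := by
    simp only [Set.mem_iUnion] at hq
    obtain ⟨i, hi, k, -, p, hp, rfl⟩ := hq
    have := hi.1
    rw [insertAt, if_neg (by omega), if_neg (by omega)]
    exact (hT i k hi).eq_none p hp _ (by omega)
  dftF_lt_iff k := by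
    simp only [Set.mem_iUnion]
    constructor
    · intro hk
      obtain ⟨i, hi, hiK⟩ := hK k hk
      rw [← dftF_truncAt hi.1, (hT i (k i) hi).dftF_lt_iff] at hk
      obtain ⟨p, hp, hpk⟩ := hk
      exact ⟨_, ⟨i, hi, k i, hiK, p, hp, rfl⟩, (forall_insertAt_iff hi.1 _ _ _).2 ⟨rfl, hpk⟩⟩
    · rintro ⟨_, ⟨i, hi, a, -, p, hp, rfl⟩, hpk⟩
      obtain ⟨rfl, hpk'⟩ := (forall_insertAt_iff hi.1 _ _ _).1 hpk
      rw [← dftF_truncAt hi.1, (hT i (k i) hi).dftF_lt_iff]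
      exact ⟨p, hp, hpk'⟩
  isTruncation q hq := by
    simp only [Set.mem_iUnion] at hq
    obtain ⟨i, hi, k, -, p, hp, rfl⟩ := hq
    obtain ⟨hclosed, htrunc, hrest⟩ := (hT i k hi).isTruncation p hp
    rw [starCount_insertAt hi.1, sum_getD_insertAt hi.1, ← subst3_truncAt, mul_add, ← add_assoc]
    exact ⟨fun j l hj hl hjl hpl => h.downwardClosed_insertAt hi k hclosed hj hl hjl hpl,
      .head ⟨i, k, rfl, hi, rfl, rfl⟩ htrunc, hrest⟩

/-- Truncation to a given defect. -/
theorem truncation_theorem (r : ℕ) (f : MvPolynomial ℕ ℤ) (C : ℕ) (hf : LDP r f C)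
    (s : ℝ) (hs : 0 ≤ s) :
    ∃ T : Set (ℕ → Option ℕ), T.Finite ∧
      (∀ p ∈ T, ∀ j, r ≤ j → p j = none) ∧
      -- (1)  S = ⋃_{p ∈ T} S(p)
      (∀ k : ℕ → ℕ, dftF r f C k < s ↔
        ∃ p ∈ T, ∀ j < r, ∀ m, p j = some m → k j = m) ∧
      -- (2)
      (∀ p ∈ T,
        -- the set of variables with `p i ≠ ∗` is downward closed for the nesting order
        (∀ i j, i < r → j < r → NestLe f i j → p j ≠ none → p i ≠ none) ∧
        -- the 3-substitution of `p` into `(f,C)` is a truncation of `(f,C)`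
        Relation.ReflTransGen DirectTrunc (r, f, C)
          (starCount r p, subst3 f p, C + 3 * ∑ i ∈ Finset.range r, (p i).getD 0) ∧
        pairDft (starCount r p) (subst3 f p)
          (C + 3 * ∑ i ∈ Finset.range r, (p i).getD 0) ≤ s ∧
        starCount r p ≤ Nat.floor s ∧
        (starCount r p = 0 →
          pairDft (starCount r p) (subst3 f p)
            (C + 3 * ∑ i ∈ Finset.range r, (p i).getD 0) < s)) := by
  have whole : ∀ {r f C}, LDP r f C → pairDft r f C ≤ s → (r = 0 → pairDft r f C < s) →
      TruncationSet r f C s {fun _ => none} := by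
    intro r f C hf hle hlt
    refine
      { finite := Set.finite_singleton _
        eq_none := by rintro _ rfl j _; rfl
        dftF_lt_iff := fun k => ⟨fun _ => ⟨_, rfl, by simp⟩, fun _ => ?_⟩
        isTruncation := ?_ }
    · rcases Nat.eq_zero_or_pos r with rfl | hr
      · rw [hf.dftF_zero_deg]
        exact hlt rfl
      · exact (hf.nestedShape.dftF_lt_pairDft hr C k).trans_le hle
    · rintro _ rfl
      have hsum : ∑ i ∈ Finset.range r, (none : Option ℕ).getD 0 = 0 := by simp
      rw [hsum, starCount_none, subst3_none, mul_zero, add_zero]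
      exact ⟨fun _ _ _ _ _ h => absurd rfl h, .refl, hle, Nat.le_floor (hf.le_pairDft.trans hle),
        hlt⟩
  suffices ∃ T, TruncationSet r f C s T by
    obtain ⟨T, hT⟩ := this
    exact ⟨T, hT.finite, hT.eq_none, hT.dftF_lt_iff, hT.isTruncation⟩
  induction r generalizing f C with
  | zero =>
    by_cases hlt : pairDft 0 f C < s
    · exact ⟨_, whole hf hlt.le fun _ => hlt⟩
    · refine ⟨∅, Set.finite_empty, by simp, fun k => ?_, by simp⟩
      rw [hf.dftF_zero_deg]
      simp [hlt]
  | succ r ih =>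
    by_cases hle : pairDft (r + 1) f C ≤ s
    · exact ⟨_, whole hf hle (by simp)⟩
    have hshape := hf.nestedShape
    obtain ⟨K, hK⟩ := hshape.exists_bound (not_le.1 hle)
    have hex : ∀ i k, ∃ T, IsMinVar (r + 1) f i →
        TruncationSet r (truncAt f i k) (C + 3 * k) s T := fun i k => by
      by_cases hi : IsMinVar (r + 1) f i
      · obtain ⟨T, hT⟩ := ih _ _ (hf.truncAt hi k)
        exact ⟨T, fun _ => hT⟩
      · exact ⟨∅, fun h => absurd h hi⟩
    choose T hT using hex
    exact ⟨_, TruncationSet.biUnion hshape hK hT⟩
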